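/- Every tournament on 23 vertices contains at most 506 directed 3-cycles, where a directed 3-cycle is a 3-element subset {u, v, w} of the vertices with r u v, r v w, and r w u. -/

import Mathlib

/-- A tournament: an irreflexive relation such that for distinct vertices
exactly one direction of the edge is present. -/
def IsTournament {V : Type*} (r : V → V → Prop) : Prop :=
  (∀ v, ¬ r v v) ∧ ∀ u v : V, u ≠ v → Xor' (r u v) (r v u)

/-- The tournament `r` contains a transitive subtournament of size `k`. -/
def HasTT {V : Type*} (r : V → V → Prop) (k : ℕ) : Prop :=
  ∃ f : Fin k → V, Function.Injective f ∧ ∀ i j : Fin k, i < j → r (f i) (f j)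
namespace IsTournament

variable {V : Type*} {r : V → V → Prop}

lemma asymm (h : IsTournament r) {u v : V} (huv : r u v) : ¬ r v u := by
  intro hvu
  have hne : u ≠ v := by
    rintro rfl
    exact h.1 u huv
  rcases h.2 u v hne with h' | h'
  · exact h'.2 hvu
  · exact h'.2 huv

lemma ite_add_ite (h : IsTournament r) [DecidableEq V] [DecidableRel r] (u v : V) :
    ((if r u v then 1 else 0) + (if r v u then 1 else 0) : ℕ) = if u = v then 0 else 1 := by
  by_cases huv : u = v
  · subst huv
    simp [h.1 u]
  · rcases h.2 u v huv with h' | h' <;> simp [h'.1, h'.2, huv]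

variable [Fintype V]

/-- Twice the sum of the out-degrees of a tournament on `n` vertices is `n * (n - 1)`. -/
lemma two_mul_sum_outdegree (h : IsTournament r) [DecidableRel r] :
    2 * ∑ v, (Finset.univ.filter (r v)).card = Fintype.card V * (Fintype.card V - 1) := by
  classical
  have hsum : ∑ v, (Finset.univ.filter (r v)).card = ∑ u, ∑ v, if r u v then 1 else 0 := by
    simp only [Finset.card_filter]
  rw [two_mul, hsum]
  nth_rewrite 2 [Finset.sum_comm]
  simp only [← Finset.sum_add_distrib, h.ite_add_ite]
  have hrow (u : V) : (∑ v, if u = v then 0 else 1) = Fintype.card V - 1 := by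
    rw [← Finset.card_univ, ← Finset.card_erase_of_mem (Finset.mem_univ u), Finset.card_eq_sum_ones,
      ← Finset.filter_ne, Finset.sum_filter]
    simp only [ne_eq, ite_not]
  simp [hrow]

/-- Directed 3-cycles and pairs of out-neighbours of a common vertex are counted by distinct
3-element sets of vertices. -/
lemma ncard_cycles_add_sum_choose_le (h : IsTournament r) [DecidableEq V] [DecidableRel r] :
    {S : Finset V | ∃ u v w : V, S = {u, v, w} ∧ r u v ∧ r v w ∧ r w u}.ncard
      + ∑ v, (Finset.univ.filter (r v)).card.choose 2 ≤ (Fintype.card V).choose 3 := by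
  classical
  set C : Set (Finset V) := {S | ∃ u v w : V, S = {u, v, w} ∧ r u v ∧ r v w ∧ r w u}
  let T (v : V) : Finset (Finset V) :=
    ((Finset.univ.filter (r v)).powersetCard 2).image (insert v)
  have hnotMem {v : V} {P : Finset V} (hP : P ⊆ Finset.univ.filter (r v)) : v ∉ P := fun hv =>
    h.1 v (Finset.mem_filter.1 (hP hv)).2
  have hTdom {v : V} {S : Finset V} (hS : S ∈ T v) :
      v ∈ S ∧ S.card = 3 ∧ ∀ x ∈ S, x ≠ v → r v x := by
    obtain ⟨P, hP, rfl⟩ := Finset.mem_image.1 hS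
    obtain ⟨hsub, hcard⟩ := Finset.mem_powersetCard.1 hP
    refine ⟨Finset.mem_insert_self _ _, ?_, fun x hx hxv => ?_⟩
    · rw [Finset.card_insert_of_notMem (hnotMem hsub), hcard]
    · exact (Finset.mem_filter.1 (hsub (Finset.mem_of_mem_insert_of_ne hx hxv))).2
  have hTcard (v : V) : (T v).card = (Finset.univ.filter (r v)).card.choose 2 := by
    rw [Finset.card_image_of_injOn, Finset.card_powersetCard]
    intro P hP Q hQ hPQ
    have hvP := hnotMem (Finset.mem_powersetCard.1 (Finset.mem_coe.1 hP)).1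
    have hvQ := hnotMem (Finset.mem_powersetCard.1 (Finset.mem_coe.1 hQ)).1
    rw [← Finset.erase_insert hvP, ← Finset.erase_insert hvQ]
    exact congrArg (fun S => S.erase v) hPQ
  have hTdisj : (↑(Finset.univ : Finset V) : Set V).PairwiseDisjoint T := by
    intro u _ v _ huv
    refine Finset.disjoint_left.2 fun S hu hv => ?_
    have hu := hTdom hu
    have hv := hTdom hv
    exact h.asymm (hu.2.2 v hv.1 huv.symm) (hv.2.2 u hu.1 huv)
  have hCT : Disjoint C.toFinset (Finset.univ.biUnion T) := by
    refine Finset.disjoint_left.2 fun S hS hS' => ?_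
    obtain ⟨u, v, w, rfl, huv, hvw, hwu⟩ := Set.mem_toFinset.1 hS
    obtain ⟨x, _, hx⟩ := Finset.mem_biUnion.1 hS'
    obtain ⟨hxS, -, hdom⟩ := hTdom hx
    have hpred {y : V} (hy : y ∈ ({u, v, w} : Finset V)) (hyx : r y x) : False := by
      refine h.asymm hyx (hdom y hy ?_)
      rintro rfl
      exact h.1 y hyx
    simp only [Finset.mem_insert, Finset.mem_singleton] at hxS
    rcases hxS with rfl | rfl | rfl
    · exact hpred (by simp) hwu
    · exact hpred (by simp) huv
    · exact hpred (by simp) hvw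
  have hsub : C.toFinset ∪ Finset.univ.biUnion T ⊆ Finset.univ.powersetCard 3 := by
    intro S hS
    refine Finset.mem_powersetCard.2 ⟨Finset.subset_univ S, ?_⟩
    rcases Finset.mem_union.1 hS with hS | hS
    · obtain ⟨u, v, w, rfl, huv, hvw, hwu⟩ := Set.mem_toFinset.1 hS
      refine Finset.card_eq_three.2 ⟨u, v, w, ?_, ?_, ?_, rfl⟩
      · rintro rfl
        exact h.1 u huv
      · rintro rfl
        exact h.1 u hwu
      · rintro rfl
        exact h.1 v hvw
    · obtain ⟨x, _, hx⟩ := Finset.mem_biUnion.1 hS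
      exact (hTdom hx).2.1
  have hle := Finset.card_le_card hsub
  rw [Finset.card_union_of_disjoint hCT, Finset.card_biUnion hTdisj,
    Finset.card_powersetCard, Finset.card_univ] at hle
  simpa only [Set.ncard_eq_toFinset_card', hTcard] using hle

end IsTournament

/-- The tangent-line bound for `d ↦ d.choose 2` touching at `k` and `k + 1`. -/
lemma mul_le_choose_two_add (d k : ℕ) : k * d ≤ d.choose 2 + (k + 1).choose 2 := by
  have hchoose (n : ℕ) : (n.choose 2 : ℤ) * 2 = n * (n - 1) := by
    induction n with
    | zero => simp
    | succ n ih =>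
      rw [Nat.choose_succ_succ' n 1, Nat.choose_one_right]
      push_cast
      linarith
  have h₁ := hchoose d
  have h₂ := hchoose (k + 1)
  push_cast at h₂
  have hsq : (0 : ℤ) ≤ ((d : ℤ) - k) * (d - k - 1) := by
    rcases le_or_gt (d : ℤ) k with hdk | hdk
    · exact mul_nonneg_of_nonpos_of_nonpos (by linarith) (by linarith)
    · exact mul_nonneg (by linarith) (by linarith)
  zify
  nlinarith

theorem cycles_23_le_506 (r : Fin 23 → Fin 23 → Prop) (h : IsTournament r) :
    {S : Finset (Fin 23) |
      ∃ u v w : Fin 23, S = {u, v, w} ∧ r u v ∧ r v w ∧ r w u}.ncard ≤ 506 := by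
  classical
  have hdeg := h.two_mul_sum_outdegree
  have hcount := h.ncard_cycles_add_sum_choose_le
  have htangent := Finset.sum_le_sum fun v (_ : v ∈ Finset.univ) =>
    mul_le_choose_two_add (Finset.univ.filter (r v)).card 11
  have hchoose : Nat.choose 23 3 = 1771 := by decide
  have hchoose' : Nat.choose (11 + 1) 2 = 66 := by decide
  rw [← Finset.mul_sum, Finset.sum_add_distrib, Finset.sum_const, Finset.card_univ,
    Fintype.card_fin, hchoose', smul_eq_mul] at htangent
  rw [Fintype.card_fin] at hdeg hcount
  rw [hchoose] at hcount
  omega
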